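/- Fix κ > 0. For each N let H_N be a random N×N real symmetric matrix. Assume: (W) there is a sequence of probability measures μ_N on ℝ, all supported in one common compact set, such that W₁(E[μ̂_{H_N}], μ_N) ≤ N^{-κ}, and each μ_N has a density μ_N(·) on the interval (−κ, κ) satisfying μ_N(x) < κ^{-1}|x|^{-1+κ} for all |x| < κ; (L) there exists ε₀ > 0 such that for every ζ > 0 there exists c_ζ > 0 with the property that for every Lipschitz f : ℝ → ℝ and every δ > 0, P(|(1/N) Tr f(H_N) − (1/N) E[Tr f(H_N)]| > δ) ≤ exp(−(c_ζ/N^ζ) · min{(Nδ/‖f‖_Lip)², (Nδ/‖f‖_Lip)^{1+ε₀}}); and the gap condition: for every ε > 0, lim_{N→∞} P(H_N has no eigenvalues in [−e^{−N^ε}, e^{−N^ε}]) = 1. Then lim_{N→∞} ( (1/N) log E[|det H_N|] − ∫_ℝ log|λ| μ_N(dλ) ) = 0. -/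

import Mathlib

open MeasureTheory ProbabilityTheory Real Filter
open scoped ENNReal

/-- The eigenvalues of a real symmetric matrix (junk value `0` if not symmetric). -/
noncomputable def eigs {N : ℕ} (M : Matrix (Fin N) (Fin N) ℝ) : Fin N → ℝ :=
  if h : M.IsHermitian then h.eigenvalues else 0

/-- The empirical spectral measure `μ̂_M = (1/N) Σ_i δ_{λ_i(M)}`. -/
noncomputable def empSpec {N : ℕ} (M : Matrix (Fin N) (Fin N) ℝ) : Measure ℝ :=
  ((N : ℝ≥0∞))⁻¹ • ∑ i : Fin N, Measure.dirac (eigs M i)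

/-- The mean empirical spectral measure `E[μ̂_H]`, i.e. `A ↦ E[μ̂_H(A)]`. -/
noncomputable def meanSpec {Ω : Type*} [MeasurableSpace Ω] (P : Measure Ω) {N : ℕ}
    (H : Ω → Matrix (Fin N) (Fin N) ℝ) : Measure ℝ :=
  P.bind fun ω => empSpec (H ω)

/-- The Wasserstein-1 distance between two measures on `ℝ`. -/
noncomputable def W1 (μ ν : Measure ℝ) : ℝ :=
  sSup {r : ℝ | ∃ f : ℝ → ℝ, (∀ x y, |f x - f y| ≤ |x - y|) ∧
    r = |(∫ x, f x ∂μ) - ∫ x, f x ∂ν|}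

namespace Matrix.IsHermitian

variable {n : Type*} [Fintype n] [DecidableEq n]

/-- The trace of a function of a Hermitian matrix is the sum over its eigenvalues. -/
theorem trace_cfc_eq_sum {A : Matrix n n ℝ} (hA : A.IsHermitian) (f : ℝ → ℝ) :
    (_root_.cfc f A).trace = ∑ i, f (hA.eigenvalues i) := by
  rw [hA.cfc_eq, IsHermitian.cfc, Unitary.conjStarAlgAut_apply, Matrix.trace_mul_cycle]
  simp [Matrix.trace_diagonal]

theorem trace_aeval_eq_sum {A : Matrix n n ℝ} (hA : A.IsHermitian) (p : Polynomial ℝ) :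
    (Polynomial.aeval A p).trace = ∑ i, p.eval (hA.eigenvalues i) := by
  have hA' : IsSelfAdjoint A := hA
  rw [← cfc_polynomial p A hA', hA.trace_cfc_eq_sum]

end Matrix.IsHermitian

theorem eigs_eq {N : ℕ} {M : Matrix (Fin N) (Fin N) ℝ} (h : M.IsHermitian) :
    eigs M = h.eigenvalues := dif_pos h

theorem abs_det_eq_prod_eigs {N : ℕ} {M : Matrix (Fin N) (Fin N) ℝ} (h : M.IsHermitian) :
    |M.det| = ∏ i, |eigs M i| := by
  rw [h.det_eq_prod_eigenvalues, eigs_eq h, ← Finset.abs_prod]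
  simp

section Measurability

variable {Ω : Type*} [MeasurableSpace Ω] {N : ℕ} {H : Ω → Matrix (Fin N) (Fin N) ℝ}

theorem measurable_matrix_pow_apply (hmeas : ∀ i j, Measurable fun ω => H ω i j) (k : ℕ) :
    ∀ i j, Measurable fun ω => (H ω ^ k) i j := by
  induction k with
  | zero => intro i j; simp only [pow_zero]; exact measurable_const
  | succ k ih =>
    intro i j
    simp only [pow_succ, Matrix.mul_apply]
    exact Finset.measurable_sum _ fun l _ => (ih i l).mul (hmeas l j)

theorem measurable_trace_aeval (hmeas : ∀ i j, Measurable fun ω => H ω i j)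
    (p : Polynomial ℝ) : Measurable fun ω => (Polynomial.aeval (H ω) p).trace := by
  simp only [Polynomial.aeval_eq_sum_range, Matrix.trace, Matrix.diag_apply, Matrix.sum_apply,
    Matrix.smul_apply, smul_eq_mul]
  exact Finset.measurable_sum _ fun i _ => Finset.measurable_sum _ fun k _ =>
    (measurable_matrix_pow_apply hmeas k i i).const_mul _

theorem measurable_det_of_apply (hmeas : ∀ i j, Measurable fun ω => H ω i j) :
    Measurable fun ω => (H ω).det := by
  simp only [Matrix.det_apply]
  exact Finset.measurable_sum _ fun σ _ =>
    (Finset.measurable_prod _ fun i _ => hmeas _ _).const_smul _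

/-- Continuous linear statistics of the eigenvalues are measurable, by Weierstrass
approximation. -/
theorem measurable_sum_eigs (hmeas : ∀ i j, Measurable fun ω => H ω i j)
    (hsymm : ∀ ω, (H ω).IsHermitian) {f : ℝ → ℝ} (hf : Continuous f) :
    Measurable fun ω => ∑ i, f (eigs (H ω) i) := by
  have hp : ∀ n : ℕ, ∃ p : Polynomial ℝ, ∀ x ∈ Set.Icc (-(n : ℝ)) n,
      |p.eval x - f x| < 1 / ((n : ℝ) + 1) := fun n =>
    exists_polynomial_near_of_continuousOn _ _ f hf.continuousOn _ (by positivity)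
  choose p hp using hp
  refine measurable_of_tendsto_metrizable (f := fun n ω => (Polynomial.aeval (H ω) (p n)).trace)
    (fun n => measurable_trace_aeval hmeas (p n)) ?_
  rw [tendsto_pi_nhds]
  intro ω
  simp only [(hsymm ω).trace_aeval_eq_sum, eigs_eq (hsymm ω)]
  refine tendsto_finsetSum _ fun i _ => ?_
  rw [tendsto_iff_dist_tendsto_zero]
  refine squeeze_zero' (Eventually.of_forall fun _ => dist_nonneg) ?_
    tendsto_one_div_add_atTop_nhds_zero_nat
  filter_upwards [eventually_ge_atTop ⌈|(hsymm ω).eigenvalues i|⌉₊] with n hn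
  rw [Real.dist_eq]
  exact (hp n _ (abs_le.mp (Nat.ceil_le.mp hn))).le

theorem isProbabilityMeasure_empSpec (hN : N ≠ 0) (M : Matrix (Fin N) (Fin N) ℝ) :
    IsProbabilityMeasure (empSpec M) := by
  refine ⟨?_⟩
  simp only [empSpec, Measure.smul_apply, Measure.finsetSum_apply, measure_univ,
    Finset.sum_const, Finset.card_univ, Fintype.card_fin, nsmul_eq_mul, mul_one, smul_eq_mul]
  exact ENNReal.inv_mul_cancel (by exact_mod_cast hN) (ENNReal.natCast_ne_top N)

theorem integral_empSpec (M : Matrix (Fin N) (Fin N) ℝ) (f : ℝ → ℝ) :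
    ∫ x, f x ∂(empSpec M) = (N : ℝ)⁻¹ * ∑ i, f (eigs M i) := by
  rw [empSpec, integral_smul_measure, integral_finsetSum_measure]
  · simp
  · intro i _
    exact integrable_dirac (by finiteness)

theorem integrable_empSpec (hN : N ≠ 0) (M : Matrix (Fin N) (Fin N) ℝ) (f : ℝ → ℝ) :
    Integrable f (empSpec M) := by
  refine Integrable.smul_measure ?_ (by simpa using hN)
  rw [integrable_finsetSum_measure]
  exact fun i _ => integrable_dirac (by finiteness)

theorem lintegral_empSpec (M : Matrix (Fin N) (Fin N) ℝ) (f : ℝ → ℝ≥0∞) :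
    ∫⁻ x, f x ∂(empSpec M) = (N : ℝ≥0∞)⁻¹ * ∑ i, f (eigs M i) := by
  rw [empSpec, lintegral_smul_measure, lintegral_finsetSum_measure]
  simp

theorem measurable_empSpec (hN : N ≠ 0) (hmeas : ∀ i j, Measurable fun ω => H ω i j)
    (hsymm : ∀ ω, (H ω).IsHermitian) : Measurable fun ω => empSpec (H ω) := by
  have := fun ω => isProbabilityMeasure_empSpec hN (H ω)
  refine Measurable.measure_of_isPiSystem_of_isProbabilityMeasure
    (borel_eq_generateFrom_isClosed (α := ℝ) ▸ BorelSpace.measurable_eq) isPiSystem_isClosed ?_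
  intro F hF
  have hF' : IsClosed F := hF
  have hδ : ∀ n : ℕ, (0 : ℝ) < 1 / ((n : ℝ) + 1) := fun n => by positivity
  refine measurable_of_tendsto_metrizable
    (f := fun (n : ℕ) ω => ∫⁻ x, (thickenedIndicator (hδ n) F x : ℝ≥0∞) ∂(empSpec (H ω))) ?_ ?_
  · intro n
    simp only [lintegral_empSpec]
    have h1 := measurable_sum_eigs hmeas hsymm (f := fun x => (thickenedIndicator (hδ n) F x : ℝ))
      (NNReal.continuous_coe.comp (thickenedIndicator (hδ n) F).continuous)
    convert (h1.ennreal_ofReal.const_mul ((N : ℝ≥0∞)⁻¹)) using 3 with ω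
    rw [ENNReal.ofReal_sum_of_nonneg (fun i _ => NNReal.coe_nonneg _)]
    simp
  · rw [tendsto_pi_nhds]
    intro ω
    have := tendsto_lintegral_thickenedIndicator_of_isClosed (empSpec (H ω)) hF' hδ
      tendsto_one_div_add_atTop_nhds_zero_nat
    exact this

theorem isProbabilityMeasure_meanSpec (P : Measure Ω) [IsProbabilityMeasure P] (hN : N ≠ 0)
    (hmeas : ∀ i j, Measurable fun ω => H ω i j) (hsymm : ∀ ω, (H ω).IsHermitian) :
    IsProbabilityMeasure (meanSpec P H) :=
  isProbabilityMeasure_bind (measurable_empSpec hN hmeas hsymm).aemeasurable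
    (Eventually.of_forall fun ω => isProbabilityMeasure_empSpec hN (H ω))

theorem integrable_meanSpec {P : Measure Ω} (hN : N ≠ 0)
    (hmeas : ∀ i j, Measurable fun ω => H ω i j) (hsymm : ∀ ω, (H ω).IsHermitian)
    {f : ℝ → ℝ} (hf : Continuous f) (hint : Integrable (fun ω => ∑ i, |f (eigs (H ω) i)|) P) :
    Integrable f (meanSpec P H) := by
  let k : Kernel Ω ℝ := ⟨fun ω => empSpec (H ω), measurable_empSpec hN hmeas hsymm⟩
  change Integrable f (P.bind k)
  rw [Measure.integrable_comp_iff hf.aestronglyMeasurable]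
  refine ⟨Eventually.of_forall fun ω => integrable_empSpec hN (H ω) f, ?_⟩
  change Integrable (fun ω => ∫ y, ‖f y‖ ∂(empSpec (H ω))) P
  simp only [integral_empSpec, Real.norm_eq_abs]
  exact hint.const_mul _

theorem integral_meanSpec {P : Measure Ω} (hN : N ≠ 0)
    (hmeas : ∀ i j, Measurable fun ω => H ω i j) (hsymm : ∀ ω, (H ω).IsHermitian)
    {f : ℝ → ℝ} (hf : Integrable f (meanSpec P H)) :
    ∫ x, f x ∂(meanSpec P H) = (N : ℝ)⁻¹ * ∫ ω, ∑ i, f (eigs (H ω) i) ∂P := by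
  let k : Kernel Ω ℝ := ⟨fun ω => empSpec (H ω), measurable_empSpec hN hmeas hsymm⟩
  have hk : meanSpec P H = (k ∘ₖ Kernel.const Unit P) () :=
    Measure.comp_eq_comp_const_apply (κ := k)
  rw [← integral_const_mul]
  simp only [← integral_empSpec]
  rw [hk] at hf ⊢
  rw [Kernel.integral_comp hf]
  simp [k]

end Measurability

/-- A sub-exponential tail of rate `2` bounds the exponential moment. -/
theorem lintegral_exp_le_of_tail {Ω : Type*} [MeasurableSpace Ω] (P : Measure Ω)
    [IsProbabilityMeasure P] {Y : Ω → ℝ} (hY : Measurable Y) {T : ℝ} (hT : 0 ≤ T)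
    (htail : ∀ t, T ≤ t → (P {ω | t < Y ω}).toReal ≤ Real.exp (-(2 * t))) :
    ∫⁻ ω, ENNReal.ofReal (Real.exp (Y ω)) ∂P ≤ ENNReal.ofReal (2 * Real.exp T) := by
  have hpos : 0 < Real.exp T := Real.exp_pos T
  rw [lintegral_eq_lintegral_meas_lt P (Eventually.of_forall fun ω => (Real.exp_pos _).le)
    (Real.measurable_exp.comp hY).aemeasurable, ← Set.Ioc_union_Ioi_eq_Ioi hpos.le,
    lintegral_union measurableSet_Ioi Set.Ioc_disjoint_Ioi_same, two_mul,
    ENNReal.ofReal_add hpos.le hpos.le]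
  gcongr
  · calc ∫⁻ s in Set.Ioc 0 (Real.exp T), P {ω | s < Real.exp (Y ω)}
        ≤ ∫⁻ _ in Set.Ioc 0 (Real.exp T), 1 := lintegral_mono fun s => prob_le_one
      _ = ENNReal.ofReal (Real.exp T) := by simp
  · calc ∫⁻ s in Set.Ioi (Real.exp T), P {ω | s < Real.exp (Y ω)}
        ≤ ∫⁻ s in Set.Ioi (Real.exp T), ENNReal.ofReal (s ^ (-2 : ℝ)) := by
          refine setLIntegral_mono' measurableSet_Ioi fun s hs => ?_
          have hs0 : 0 < s := hpos.trans hs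
          have h := htail (Real.log s) ((Real.le_log_iff_exp_le hs0).2 (le_of_lt hs))
          have hset : {ω | s < Real.exp (Y ω)} = {ω | Real.log s < Y ω} := by
            ext ω
            exact (Real.log_lt_iff_lt_exp hs0).symm
          rw [hset, ← ENNReal.ofReal_toReal (measure_ne_top P {ω | Real.log s < Y ω})]
          refine ENNReal.ofReal_le_ofReal (h.trans_eq ?_)
          rw [Real.rpow_def_of_pos hs0]
          ring_nf
      _ = ENNReal.ofReal (∫ s in Set.Ioi (Real.exp T), s ^ (-2 : ℝ)) := by
          refine (ofReal_integral_eq_lintegral_ofReal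
            (integrableOn_Ioi_rpow_of_lt (by norm_num) hpos) ?_).symm
          filter_upwards [ae_restrict_mem measurableSet_Ioi] with s hs
          exact Real.rpow_nonneg (hpos.trans hs).le _
      _ ≤ ENNReal.ofReal (Real.exp T) := by
          refine ENNReal.ofReal_le_ofReal ?_
          rw [integral_Ioi_rpow_of_lt (by norm_num) hpos, ← Real.exp_mul]
          norm_num
          linarith

theorem integrable_of_lipschitz {ν : Measure ℝ} [IsFiniteMeasure ν]
    (hν : Integrable (fun x : ℝ => |x|) ν) {f : ℝ → ℝ} (hf : Continuous f) {L : ℝ}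
    (hL : ∀ x y, |f x - f y| ≤ L * |x - y|) : Integrable f ν := by
  refine Integrable.mono' ((integrable_const |f 0|).add (hν.const_mul L))
    hf.aestronglyMeasurable (Eventually.of_forall fun x => ?_)
  have h1 := hL x 0
  have h2 := abs_sub_abs_le_abs_sub (f x) (f 0)
  simp only [sub_zero] at h1
  simp only [Pi.add_apply, Real.norm_eq_abs]
  linarith

theorem continuous_of_abs_sub_le {f : ℝ → ℝ} {L : ℝ}
    (hL : ∀ x y, |f x - f y| ≤ L * |x - y|) : Continuous f := by
  refine (LipschitzWith.of_dist_le_mul (K := L.toNNReal) fun x y => ?_).continuous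
  rw [Real.dist_eq, Real.dist_eq]
  exact (hL x y).trans (by gcongr; exact Real.le_coe_toNNReal L)

theorem abs_integral_sub_le_W1 {ν μ : Measure ℝ} [IsProbabilityMeasure ν]
    [IsProbabilityMeasure μ] (hν : Integrable (fun x : ℝ => |x|) ν)
    (hμ : Integrable (fun x : ℝ => |x|) μ) {f : ℝ → ℝ} {L : ℝ} (hL : 0 < L)
    (hf : ∀ x y, |f x - f y| ≤ L * |x - y|) :
    |(∫ x, f x ∂ν) - ∫ x, f x ∂μ| ≤ L * W1 ν μ := by
  have hbdd : BddAbove {r : ℝ | ∃ g : ℝ → ℝ, (∀ x y, |g x - g y| ≤ |x - y|) ∧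
      r = |(∫ x, g x ∂ν) - ∫ x, g x ∂μ|} := by
    refine ⟨(∫ x, |x| ∂ν) + ∫ x, |x| ∂μ, ?_⟩
    rintro r ⟨g, hg, rfl⟩
    have hg1 : ∀ x y, |g x - g y| ≤ 1 * |x - y| := fun x y => by simpa using hg x y
    have hgc := continuous_of_abs_sub_le hg1
    have key : ∀ (τ : Measure ℝ) [IsProbabilityMeasure τ], Integrable (fun x : ℝ => |x|) τ →
        |(∫ x, g x ∂τ) - g 0| ≤ ∫ x, |x| ∂τ := by
      intro τ _ hτ
      have hgi := integrable_of_lipschitz hτ hgc hg1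
      have : (∫ x, g x ∂τ) - g 0 = ∫ x, (g x - g 0) ∂τ := by
        rw [integral_sub hgi (integrable_const _)]
        simp
      rw [this]
      refine (abs_integral_le_integral_abs).trans
        (integral_mono (hgi.sub (integrable_const _)).abs hτ fun x => ?_)
      simpa using hg x 0
    have h1 := abs_le.mp (key ν hν)
    have h2 := abs_le.mp (key μ hμ)
    rw [abs_le]
    constructor <;> linarith [h1.1, h1.2, h2.1, h2.2]
  have hmem : |(∫ x, L⁻¹ * f x ∂ν) - ∫ x, L⁻¹ * f x ∂μ| ≤ W1 ν μ := by
    refine le_csSup hbdd ⟨fun x => L⁻¹ * f x, fun x y => ?_, rfl⟩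
    rw [← mul_sub, abs_mul, abs_of_pos (inv_pos.2 hL), inv_mul_le_iff₀ hL]
    exact hf x y
  rw [integral_const_mul, integral_const_mul, ← mul_sub, abs_mul, abs_of_pos (inv_pos.2 hL),
    inv_mul_le_iff₀ hL] at hmem
  exact hmem

theorem eventually_le_concentration_rate {ε₀ c b δ : ℝ} (hε₀ : 0 < ε₀) (hc : 0 < c)
    (hδ : 0 < δ) (hb : 0 < b) (hb' : 8 * b ≤ min 1 ε₀) :
    ∀ᶠ N : ℕ in atTop, ∀ t : ℝ, (N : ℝ) * δ ≤ t →
      2 * t ≤ c / (N : ℝ) ^ (min 1 ε₀ / 4) *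
        min ((t / (2 * (N : ℝ) ^ b)) ^ (2 : ℝ)) ((t / (2 * (N : ℝ) ^ b)) ^ (1 + ε₀)) := by
  set e := min 1 ε₀ with he
  have he0 : 0 < e := lt_min one_pos hε₀
  have he1 : e ≤ 1 := min_le_left _ _
  have hee : e ≤ ε₀ := min_le_right _ _
  have hD : 0 < c * (δ / 2) ^ e := by positivity
  have t1 : Tendsto (fun N : ℕ => c * (δ / 2) ^ e * (N : ℝ) ^ (e / 2)) atTop atTop :=
    ((tendsto_rpow_atTop (by positivity)).comp tendsto_natCast_atTop_atTop).const_mul_atTop hD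
  have t2 : Tendsto (fun N : ℕ => δ / 2 * (N : ℝ) ^ (1 - b)) atTop atTop :=
    ((tendsto_rpow_atTop (by linarith)).comp
      tendsto_natCast_atTop_atTop).const_mul_atTop (by positivity)
  filter_upwards [t1.eventually_ge_atTop 4, t2.eventually_ge_atTop 1, eventually_ge_atTop 1]
    with N h4 h1 hN t ht
  have hN1 : (1 : ℝ) ≤ N := by exact_mod_cast hN
  have hN0 : (0 : ℝ) < N := by linarith
  set v := δ / 2 * (N : ℝ) ^ (1 - b) with hv
  set u := t / (2 * (N : ℝ) ^ b) with hu
  have hNb : 0 < (N : ℝ) ^ b := Real.rpow_pos_of_pos hN0 _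
  have hvu : v ≤ u := by
    rw [hu, le_div_iff₀ (by positivity), hv]
    calc δ / 2 * (N : ℝ) ^ (1 - b) * (2 * (N : ℝ) ^ b)
        = δ * ((N : ℝ) ^ (1 - b) * (N : ℝ) ^ b) := by ring
      _ = N * δ := by rw [← Real.rpow_add hN0]; simp [mul_comm]
      _ ≤ t := ht
  have hu1 : 1 ≤ u := h1.trans hvu
  have ht0 : 0 < t := lt_of_lt_of_le (by positivity) ht
  have hmin : u * v ^ e ≤ min (u ^ (2 : ℝ)) (u ^ (1 + ε₀)) := by
    have : u * v ^ e ≤ u ^ (1 + e) := by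
      rw [Real.rpow_add (by linarith), Real.rpow_one]
      gcongr
    refine this.trans (le_min ?_ ?_) <;> exact Real.rpow_le_rpow_of_exponent_le hu1 (by linarith)
  have hexp : (N : ℝ) ^ (e / 2) ≤ (N : ℝ) ^ ((1 - b) * e - e / 4 - b) :=
    Real.rpow_le_rpow_of_exponent_le hN1 (by nlinarith)
  calc 2 * t = t / 2 * 4 := by ring
    _ ≤ t / 2 * (c * (δ / 2) ^ e * (N : ℝ) ^ ((1 - b) * e - e / 4 - b)) := by
        gcongr
        exact h4.trans (by gcongr)
    _ = c / (N : ℝ) ^ (e / 4) * (u * v ^ e) := by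
        rw [hv, Real.mul_rpow (by positivity) (by positivity), ← Real.rpow_mul hN0.le,
          Real.rpow_sub hN0, Real.rpow_sub hN0, hu]
        field_simp
    _ ≤ _ := by gcongr

theorem eventually_lintegral_exp_le {κ ε₀ c b δ : ℝ} {Ω : ℕ → Type*}
    [∀ N, MeasurableSpace (Ω N)] (P : ∀ N, Measure (Ω N)) [∀ N, IsProbabilityMeasure (P N)]
    {H : ∀ N, Ω N → Matrix (Fin N) (Fin N) ℝ}
    (hmeas : ∀ N, ∀ i j, Measurable fun ω => H N ω i j)
    (hsymm : ∀ N ω, (H N ω).IsHermitian)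
    (μ : ℕ → Measure ℝ) [∀ N, IsProbabilityMeasure (μ N)]
    (hμ : ∀ N, Integrable (fun x : ℝ => |x|) (μ N))
    (hW1 : ∀ N : ℕ, 1 ≤ N → W1 (meanSpec (P N) (H N)) (μ N) ≤ (N : ℝ) ^ (-κ))
    (hε₀ : 0 < ε₀) (hc : 0 < c) (hδ : 0 < δ) (hb : 0 < b) (hb' : 8 * b ≤ min 1 ε₀)
    (hbκ : b < κ)
    (hLip : ∀ N : ℕ, 1 ≤ N → ∀ f : ℝ → ℝ, ∀ L : ℝ, 0 < L →
        (∀ x y, |f x - f y| ≤ L * |x - y|) → ∀ δ : ℝ, 0 < δ →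
        (P N {ω | δ < |(N : ℝ)⁻¹ * (∑ i, f (eigs (H N ω) i))
            - (N : ℝ)⁻¹ * ∫ ω', (∑ i, f (eigs (H N ω') i)) ∂(P N)|}).toReal
          ≤ Real.exp (-(c / (N : ℝ) ^ (min 1 ε₀ / 4)) *
              min (((N : ℝ) * δ / L) ^ (2 : ℝ)) (((N : ℝ) * δ / L) ^ (1 + ε₀)))) :
    ∀ᶠ N : ℕ in atTop, ∀ f : ℝ → ℝ, (∀ x y, |f x - f y| ≤ 2 * (N : ℝ) ^ b * |x - y|) →
      ∫⁻ ω, ENNReal.ofReal (Real.exp |(∑ i, f (eigs (H N ω) i)) - N * ∫ x, f x ∂(μ N)|) ∂(P N)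
        ≤ ENNReal.ofReal (Real.exp (N * δ)) := by
  have t1 : Tendsto (fun N : ℕ => 2 * (N : ℝ) ^ (-(κ - b))) atTop (nhds (2 * 0)) :=
    ((tendsto_rpow_neg_atTop (sub_pos.2 hbκ)).comp tendsto_natCast_atTop_atTop).const_mul 2
  rw [mul_zero] at t1
  have t2 : Tendsto (fun N : ℕ => (N : ℝ) * (δ / 2)) atTop atTop :=
    tendsto_natCast_atTop_atTop.atTop_mul_const (by positivity)
  filter_upwards [eventually_le_concentration_rate hε₀ hc (show 0 < δ / 4 by positivity) hb hb',
    t1.eventually (ge_mem_nhds (show 0 < δ / 4 by positivity)),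
    t2.eventually_ge_atTop (Real.log 2), eventually_ge_atTop 1] with N hrate hW h2 hN
  have hN1 : (1 : ℝ) ≤ N := by exact_mod_cast hN
  have hN0 : (0 : ℝ) < N := by linarith
  have hN' : N ≠ 0 := by lia
  have hNb : 1 ≤ (N : ℝ) ^ b := Real.one_le_rpow hN1 hb.le
  have hL0 : 0 < 2 * (N : ℝ) ^ b := by positivity
  have hcent : ∀ f : ℝ → ℝ, (∀ x y, |f x - f y| ≤ 2 * (N : ℝ) ^ b * |x - y|) →
      ∫⁻ ω, ENNReal.ofReal (Real.exp |(∑ i, f (eigs (H N ω) i))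
        - ∫ ω', (∑ i, f (eigs (H N ω') i)) ∂(P N)|) ∂(P N)
        ≤ ENNReal.ofReal (2 * Real.exp (N * (δ / 4))) := by
    intro f hf
    have hmf := measurable_sum_eigs (hmeas N) (hsymm N) (continuous_of_abs_sub_le hf)
    refine lintegral_exp_le_of_tail (P N) (hmf.sub_const _).abs (by positivity) fun t ht => ?_
    have ht0 : 0 < t := lt_of_lt_of_le (by positivity) ht
    have h := hLip N hN f _ hL0 hf (t / N) (by positivity)
    rw [mul_div_cancel₀ t hN0.ne'] at h
    have hset : {ω | t / N < |(N : ℝ)⁻¹ * (∑ i, f (eigs (H N ω) i))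
        - (N : ℝ)⁻¹ * ∫ ω', (∑ i, f (eigs (H N ω') i)) ∂(P N)|}
        = {ω | t < |(∑ i, f (eigs (H N ω) i))
          - ∫ ω', (∑ i, f (eigs (H N ω') i)) ∂(P N)|} := by
      ext ω
      simp only [Set.mem_ofPred_eq]
      rw [← mul_sub, abs_mul, abs_of_pos (inv_pos.2 hN0), div_eq_inv_mul,
        mul_lt_mul_iff_right₀ (inv_pos.2 hN0)]
    rw [hset] at h
    refine h.trans (Real.exp_le_exp.2 ?_)
    rw [neg_mul]
    exact neg_le_neg (hrate t ht)
  have hprob := isProbabilityMeasure_meanSpec (P N) hN' (hmeas N) (hsymm N)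
  have habs : Integrable (fun x : ℝ => |x|) (meanSpec (P N) (H N)) := by
    refine integrable_meanSpec hN' (hmeas N) (hsymm N) continuous_abs ?_
    simp only [abs_abs]
    have h := hcent (fun x => |x|) fun x y =>
      (abs_abs_sub_abs_le_abs_sub x y).trans (le_mul_of_one_le_left (abs_nonneg _) (by linarith))
    have hm := measurable_sum_eigs (hmeas N) (hsymm N) continuous_abs
    set m := ∫ ω', (∑ i, |eigs (H N ω') i|) ∂(P N)
    have hexp : Integrable (fun ω => Real.exp |(∑ i, |eigs (H N ω) i|) - m|) (P N) := by
      refine ⟨(Real.measurable_exp.comp (hm.sub_const m).abs).aestronglyMeasurable, ?_⟩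
      rw [hasFiniteIntegral_iff_ofReal (Eventually.of_forall fun ω => (Real.exp_pos _).le)]
      exact h.trans_lt ENNReal.ofReal_lt_top
    refine Integrable.mono' ((integrable_const |m|).add hexp) hm.aestronglyMeasurable
      (Eventually.of_forall fun ω => ?_)
    have h1 := Real.add_one_le_exp |(∑ i, |eigs (H N ω) i|) - m|
    have h2 := abs_sub_abs_le_abs_sub (∑ i, |eigs (H N ω) i|) m
    simp only [Pi.add_apply, Real.norm_eq_abs]
    linarith
  intro f hf
  have hfc := continuous_of_abs_sub_le hf
  have hbias : |(∫ ω', (∑ i, f (eigs (H N ω') i)) ∂(P N)) - N * ∫ x, f x ∂(μ N)|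
      ≤ N * (δ / 4) := by
    have h := abs_integral_sub_le_W1 habs (hμ N) hL0 hf
    rw [integral_meanSpec hN' (hmeas N) (hsymm N) (integrable_of_lipschitz habs hfc hf)] at h
    have h' : 2 * (N : ℝ) ^ b * W1 (meanSpec (P N) (H N)) (μ N) ≤ δ / 4 := by
      refine le_trans (mul_le_mul_of_nonneg_left (hW1 N hN) hL0.le) (le_trans (le_of_eq ?_) hW)
      rw [mul_assoc, ← Real.rpow_add hN0]
      ring_nf
    set m := ∫ ω', (∑ i, f (eigs (H N ω') i)) ∂(P N)
    have : m - N * ∫ x, f x ∂(μ N) = N * ((N : ℝ)⁻¹ * m - ∫ x, f x ∂(μ N)) := by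
      field_simp
    rw [this, abs_mul, abs_of_pos hN0]
    gcongr
    exact h.trans h'
  set m := ∫ ω', (∑ i, f (eigs (H N ω') i)) ∂(P N)
  calc _ ≤ ∫⁻ ω, ENNReal.ofReal (Real.exp (N * (δ / 4))) *
          ENNReal.ofReal (Real.exp |(∑ i, f (eigs (H N ω) i)) - m|) ∂(P N) := by
        refine lintegral_mono fun ω => ?_
        rw [← ENNReal.ofReal_mul (Real.exp_pos _).le, ← Real.exp_add]
        refine ENNReal.ofReal_le_ofReal (Real.exp_le_exp.2 ?_)
        have := abs_sub_le (∑ i, f (eigs (H N ω) i)) m (N * ∫ x, f x ∂(μ N))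
        linarith
    _ ≤ ENNReal.ofReal (Real.exp (N * (δ / 4))) *
          ENNReal.ofReal (2 * Real.exp (N * (δ / 4))) := by
        rw [lintegral_const_mul' _ _ ENNReal.ofReal_ne_top]
        gcongr
        exact hcent f hf
    _ ≤ _ := by
        rw [← ENNReal.ofReal_mul (Real.exp_pos _).le]
        refine ENNReal.ofReal_le_ofReal ?_
        have h2' : 2 ≤ Real.exp (N * (δ / 2)) := (Real.log_le_iff_le_exp two_pos).1 h2
        calc _ = 2 * Real.exp (N * (δ / 2)) := by
              rw [mul_left_comm, ← Real.exp_add]; ring_nf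
          _ ≤ Real.exp (N * (δ / 2)) * Real.exp (N * (δ / 2)) := by gcongr
          _ = _ := by rw [← Real.exp_add]; ring_nf

/-- The logarithm of `|x|`, truncated from below at `log η`. -/
noncomputable def logTrunc (η x : ℝ) : ℝ := Real.log (max |x| η)

/-- A bump function equal to `1` on `[-η, η]` and vanishing outside `[-2η, 2η]`. -/
noncomputable def bump (η x : ℝ) : ℝ := max 0 (min 1 (2 - |x| / η))

section Truncation

variable {η : ℝ}

theorem abs_log_sub_log_le {a b : ℝ} (hη : 0 < η) (ha : η ≤ a) (hb : η ≤ b) :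
    |Real.log a - Real.log b| ≤ η⁻¹ * |a - b| := by
  wlog h : b ≤ a generalizing a b
  · rw [abs_sub_comm, abs_sub_comm a]
    exact this hb ha (le_of_not_ge h)
  have hb0 : 0 < b := hη.trans_le hb
  have ha0 : 0 < a := hη.trans_le ha
  rw [abs_of_nonneg (sub_nonneg.2 (Real.log_le_log hb0 h)), abs_of_nonneg (sub_nonneg.2 h),
    ← Real.log_div ha0.ne' hb0.ne']
  calc Real.log (a / b) ≤ a / b - 1 := Real.log_le_sub_one_of_pos (by positivity)
    _ = b⁻¹ * (a - b) := by field_simp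
    _ ≤ η⁻¹ * (a - b) := by
        have := sub_nonneg.2 h
        gcongr

theorem abs_logTrunc_sub_le (hη : 0 < η) (x y : ℝ) :
    |logTrunc η x - logTrunc η y| ≤ η⁻¹ * |x - y| := by
  refine (abs_log_sub_log_le hη (le_max_right _ _) (le_max_right _ _)).trans ?_
  exact mul_le_mul_of_nonneg_left ((abs_max_sub_max_le_abs _ _ _).trans
    (abs_abs_sub_abs_le_abs_sub x y)) (inv_pos.2 hη).le

theorem abs_bump_sub_le (hη : 0 < η) (x y : ℝ) :
    |bump η x - bump η y| ≤ η⁻¹ * |x - y| := by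
  unfold bump
  rw [max_comm 0, max_comm 0, min_comm 1, min_comm 1]
  have hmin : ∀ a b : ℝ, |min a 1 - min b 1| ≤ |a - b| := fun a b => by
    simpa using abs_min_sub_min_le_max a 1 b 1
  refine (abs_max_sub_max_le_abs _ _ _).trans ((hmin _ _).trans ?_)
  rw [sub_sub_sub_cancel_left, ← sub_div, abs_div, abs_of_pos hη, div_eq_inv_mul, abs_sub_comm]
  exact mul_le_mul_of_nonneg_left (abs_abs_sub_abs_le_abs_sub x y) (inv_pos.2 hη).le

theorem bump_nonneg (x : ℝ) : 0 ≤ bump η x := le_max_left _ _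

theorem bump_le_one (x : ℝ) : bump η x ≤ 1 := max_le zero_le_one (min_le_left _ _)

theorem bump_eq_one (hη : 0 < η) {x : ℝ} (hx : |x| ≤ η) : bump η x = 1 := by
  have : |x| / η ≤ 1 := (div_le_one hη).2 hx
  rw [bump, min_eq_left (by linarith), max_eq_right zero_le_one]

theorem bump_eq_zero (hη : 0 < η) {x : ℝ} (hx : 2 * η ≤ |x|) : bump η x = 0 := by
  have : 2 ≤ |x| / η := (le_div_iff₀ hη).2 hx
  rw [bump, max_eq_left ((min_le_right _ _).trans (by linarith))]

end Truncation

section NearZero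

variable {μ : Measure ℝ} {κ η : ℝ}

theorem integrableOn_abs_rpow {r : ℝ} (hr : -1 < r) :
    IntegrableOn (fun x : ℝ => |x| ^ r) (Set.Ioo (-κ) κ) := by
  rcases le_or_gt κ 0 with hκ | hκ
  · rw [Set.Ioo_eq_empty (by linarith)]
    exact integrableOn_empty
  have h1 : IntegrableOn (fun x : ℝ => |x| ^ r) (Set.Ioc 0 κ) := by
    have h : IntegrableOn (fun x : ℝ => x ^ r) (Set.Ioc 0 κ) :=
      (intervalIntegrable_iff_integrableOn_Ioc_of_le hκ.le).1
        (intervalIntegral.intervalIntegrable_rpow' hr)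
    exact h.congr_fun (fun x hx => by simp only [abs_of_pos hx.1]) measurableSet_Ioc
  have h2 : IntervalIntegrable (fun x : ℝ => |x| ^ r) volume 0 κ :=
    (intervalIntegrable_iff_integrableOn_Ioc_of_le hκ.le).2 h1
  have h3 : IntervalIntegrable (fun x : ℝ => |x| ^ r) volume (-κ) 0 := by
    have := h2.symm.comp_mul_left (c := -1)
    simpa [div_neg] using this
  exact ((intervalIntegrable_iff_integrableOn_Ioc_of_le (by linarith)).1 (h3.trans h2)).mono_set
    Set.Ioo_subset_Ioc_self

/-- A density bounded by `κ⁻¹ |x|^(-1+κ)` near the origin has a finite negative moment there. -/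
theorem setLIntegral_rpow_neg_le {ρ : ℝ → ℝ}
    (hd : ∀ s ⊆ Set.Ioo (-κ) κ, MeasurableSet s → μ s = ∫⁻ x in s, ENNReal.ofReal (ρ x))
    (hρ : ∀ x : ℝ, |x| < κ → ρ x < κ⁻¹ * |x| ^ (-1 + κ)) :
    ∫⁻ x in Set.Ioo (-κ) κ, ENNReal.ofReal (|x| ^ (-(κ / 2))) ∂μ
      ≤ ∫⁻ x in Set.Ioo (-κ) κ, ENNReal.ofReal (κ⁻¹ * |x| ^ (-1 + κ / 2)) := by
  have hg : Measurable fun x : ℝ => ENNReal.ofReal (κ⁻¹ * |x| ^ (-1 + κ)) := by fun_prop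
  have hle : μ.restrict (Set.Ioo (-κ) κ) ≤ (volume.restrict (Set.Ioo (-κ) κ)).withDensity
      fun x => ENNReal.ofReal (κ⁻¹ * |x| ^ (-1 + κ)) := by
    refine Measure.le_iff.2 fun s hs => ?_
    have hm : MeasurableSet (s ∩ Set.Ioo (-κ) κ) := hs.inter measurableSet_Ioo
    rw [Measure.restrict_apply hs, withDensity_apply _ hs, Measure.restrict_restrict hs,
      hd _ Set.inter_subset_right hm]
    exact setLIntegral_mono' hm fun x hx =>
      ENNReal.ofReal_le_ofReal (hρ x (abs_lt.2 hx.2)).le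
  refine (lintegral_mono' hle le_rfl).trans ?_
  rw [lintegral_withDensity_eq_lintegral_mul _ hg (by fun_prop)]
  refine setLIntegral_mono' measurableSet_Ioo fun x hx => ?_
  have hκ : 0 < κ := by linarith [hx.1, hx.2]
  rw [Pi.mul_apply, ← ENNReal.ofReal_mul (by positivity)]
  refine ENNReal.ofReal_le_ofReal ?_
  rcases eq_or_ne x 0 with rfl | hx0
  · rw [abs_zero, Real.zero_rpow (x := -(κ / 2)) (by linarith), mul_zero]
    positivity
  · rw [mul_assoc, ← Real.rpow_add (abs_pos.2 hx0)]
    ring_nf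
    exact le_rfl

theorem measure_singleton_zero_of_density (hκ : 0 < κ) {ρ : ℝ → ℝ}
    (hd : ∀ s ⊆ Set.Ioo (-κ) κ, MeasurableSet s → μ s = ∫⁻ x in s, ENNReal.ofReal (ρ x)) :
    μ {0} = 0 := by
  rw [hd {0} (by simpa using hκ) (measurableSet_singleton 0)]
  simp

theorem integrable_of_continuous_of_support [IsFiniteMeasure μ] {R : ℝ}
    (hR : μ (Set.Icc (-R) R)ᶜ = 0) {f : ℝ → ℝ} (hf : Continuous f) : Integrable f μ := by
  have : μ.restrict (Set.Icc (-R) R) = μ := by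
    rw [Measure.restrict_eq_self_of_ae_mem]
    exact measure_eq_zero_iff_ae_notMem.1 hR |>.mono fun x hx => not_not.1 hx
  rw [← this]
  exact hf.continuousOn.integrableOn_compact isCompact_Icc

theorem logTrunc_sub_log_nonneg {x : ℝ} (hx : x ≠ 0) :
    0 ≤ logTrunc η x - Real.log |x| :=
  sub_nonneg.2 (Real.log_le_log (abs_pos.2 hx) (le_max_left _ _))

theorem logTrunc_sub_log_le {s : ℝ} (hs : 0 < s) (hη : 0 < η) (hηκ : η ≤ κ) {x : ℝ} (hx : x ≠ 0) :
    logTrunc η x - Real.log |x|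
      ≤ η ^ s / s * (Set.Ioo (-κ) κ).indicator (fun x => |x| ^ (-s)) x := by
  have hx0 := abs_pos.2 hx
  have hW : 0 ≤ (Set.Ioo (-κ) κ).indicator (fun x => |x| ^ (-s)) x :=
    Set.indicator_nonneg (fun y _ => by positivity) x
  rcases le_or_gt η |x| with h | h
  · rw [logTrunc, max_eq_left h, sub_self]
    positivity
  · rw [logTrunc, max_eq_right h.le, Set.indicator_of_mem (Set.mem_Ioo.2 (abs_lt.1 (h.trans_le hηκ))),
      ← Real.log_div hη.ne' hx0.ne']
    refine (Real.log_le_rpow_div (by positivity) hs).trans_eq ?_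
    rw [Real.div_rpow hη.le hx0.le, Real.rpow_neg hx0.le]
    ring

theorem bump_le_indicator {s : ℝ} (hs : 0 < s) (hη : 0 < η) (hηκ : 2 * η ≤ κ) {x : ℝ}
    (hx : x ≠ 0) :
    bump η x ≤ (2 * η) ^ s * (Set.Ioo (-κ) κ).indicator (fun x => |x| ^ (-s)) x := by
  have hx0 := abs_pos.2 hx
  have hW : 0 ≤ (Set.Ioo (-κ) κ).indicator (fun x => |x| ^ (-s)) x :=
    Set.indicator_nonneg (fun y _ => by positivity) x
  rcases le_or_gt (2 * η) |x| with h | h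
  · rw [bump_eq_zero hη h]
    positivity
  · rw [Set.indicator_of_mem (Set.mem_Ioo.2 (abs_lt.1 (h.trans_le hηκ))), Real.rpow_neg hx0.le,
      ← div_eq_mul_inv, ← Real.div_rpow (by positivity) hx0.le]
    exact (bump_le_one x).trans (Real.one_le_rpow ((one_le_div hx0).2 h.le) hs.le)

/-- Comparison of the truncated logarithm with the logarithm under a negative-moment bound. -/
theorem integral_logTrunc_bounds [IsProbabilityMeasure μ] {R K s : ℝ} (hs : 0 < s) (hK : 0 ≤ K)
    (hR : μ (Set.Icc (-R) R)ᶜ = 0) (h0 : μ {0} = 0)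
    (hmom : ∫⁻ x in Set.Ioo (-κ) κ, ENNReal.ofReal (|x| ^ (-s)) ∂μ ≤ ENNReal.ofReal K)
    (hη : 0 < η) (hηκ : 2 * η ≤ κ) :
    (∫ x, Real.log |x| ∂μ) ≤ ∫ x, logTrunc η x ∂μ ∧
    (∫ x, logTrunc η x ∂μ) ≤ (∫ x, Real.log |x| ∂μ) + η ^ s / s * K ∧
    (∫ x, bump η x ∂μ) ≤ (2 * η) ^ s * K := by
  set W := (Set.Ioo (-κ) κ).indicator (fun x : ℝ => |x| ^ (-s)) with hWdef
  have hpow : Measurable fun x : ℝ => |x| ^ (-s) := by fun_prop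
  have hWon : IntegrableOn (fun x : ℝ => |x| ^ (-s)) (Set.Ioo (-κ) κ) μ := by
    refine ⟨hpow.aestronglyMeasurable, ?_⟩
    rw [hasFiniteIntegral_iff_ofReal (Eventually.of_forall fun x => by positivity)]
    exact hmom.trans_lt ENNReal.ofReal_lt_top
  have hW : Integrable W μ := hWon.integrable_indicator measurableSet_Ioo
  have hWK : ∫ x, W x ∂μ ≤ K := by
    rw [hWdef, integral_indicator measurableSet_Ioo, integral_eq_lintegral_of_nonneg_ae
      (Eventually.of_forall fun x => by positivity) hpow.aestronglyMeasurable]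
    exact ENNReal.toReal_le_of_le_ofReal hK hmom
  have hne : ∀ᵐ x ∂μ, x ≠ 0 := by
    filter_upwards [measure_eq_zero_iff_ae_notMem.1 h0] with x hx using hx
  have hf : Integrable (logTrunc η) μ := integrable_of_continuous_of_support hR
    (continuous_of_abs_sub_le (abs_logTrunc_sub_le hη))
  have hg : Integrable (bump η) μ := integrable_of_continuous_of_support hR
    (continuous_of_abs_sub_le (abs_bump_sub_le hη))
  have hlogm : Measurable fun x : ℝ => Real.log |x| := by fun_prop
  have hd : Integrable (fun x => logTrunc η x - Real.log |x|) μ := by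
    refine Integrable.mono' (hW.const_mul (η ^ s / s))
      (hf.aestronglyMeasurable.sub hlogm.aestronglyMeasurable) ?_
    filter_upwards [hne] with x hx
    rw [Real.norm_eq_abs, abs_of_nonneg (logTrunc_sub_log_nonneg hx)]
    exact logTrunc_sub_log_le hs hη (by linarith) hx
  have hlog : Integrable (fun x : ℝ => Real.log |x|) μ := by
    refine (hf.sub hd).congr (Eventually.of_forall fun x => ?_)
    simp
  have hdint : ∫ x, (logTrunc η x - Real.log |x|) ∂μ
      = (∫ x, logTrunc η x ∂μ) - ∫ x, Real.log |x| ∂μ := integral_sub hf hlog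
  refine ⟨?_, ?_, ?_⟩
  · have : 0 ≤ ∫ x, (logTrunc η x - Real.log |x|) ∂μ :=
      integral_nonneg_of_ae (hne.mono fun x hx => logTrunc_sub_log_nonneg hx)
    linarith
  · have : ∫ x, (logTrunc η x - Real.log |x|) ∂μ ≤ ∫ x, η ^ s / s * W x ∂μ :=
      integral_mono_ae hd (hW.const_mul _)
        (hne.mono fun x hx => logTrunc_sub_log_le hs hη (by linarith) hx)
    rw [integral_const_mul] at this
    have h2 : η ^ s / s * ∫ x, W x ∂μ ≤ η ^ s / s * K := by gcongr
    linarith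
  · have : ∫ x, bump η x ∂μ ≤ ∫ x, (2 * η) ^ s * W x ∂μ :=
      integral_mono_ae hg (hW.const_mul _)
        (hne.mono fun x hx => bump_le_indicator hs hη hηκ hx)
    rw [integral_const_mul] at this
    exact this.trans (by gcongr)

end NearZero

section Determinant

variable {Ω : Type*} [MeasurableSpace Ω] {P : Measure Ω} {N : ℕ}
  {H : Ω → Matrix (Fin N) (Fin N) ℝ} {η A B : ℝ}

theorem lintegral_abs_det_le (hsymm : ∀ ω, (H ω).IsHermitian) (hη : 0 < η)
    (hB : ∫⁻ ω, ENNReal.ofReal (Real.exp |(∑ i, logTrunc η (eigs (H ω) i)) - A|) ∂P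
      ≤ ENNReal.ofReal (Real.exp B)) :
    ∫⁻ ω, ENNReal.ofReal |(H ω).det| ∂P ≤ ENNReal.ofReal (Real.exp (A + B)) := by
  calc ∫⁻ ω, ENNReal.ofReal |(H ω).det| ∂P
      ≤ ∫⁻ ω, ENNReal.ofReal (Real.exp A) *
          ENNReal.ofReal (Real.exp |(∑ i, logTrunc η (eigs (H ω) i)) - A|) ∂P := by
        refine lintegral_mono fun ω => ?_
        rw [← ENNReal.ofReal_mul (Real.exp_pos _).le, ← Real.exp_add]
        refine ENNReal.ofReal_le_ofReal ?_
        rw [abs_det_eq_prod_eigs (hsymm ω)]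
        calc ∏ i, |eigs (H ω) i| ≤ ∏ i, Real.exp (logTrunc η (eigs (H ω) i)) := by
              refine Finset.prod_le_prod (fun i _ => abs_nonneg _) fun i _ => ?_
              rw [logTrunc, Real.exp_log (lt_max_of_lt_right hη)]
              exact le_max_left _ _
          _ = Real.exp (∑ i, logTrunc η (eigs (H ω) i)) := (Real.exp_sum _ _).symm
          _ ≤ _ := Real.exp_le_exp.2 (by
              linarith [le_abs_self ((∑ i, logTrunc η (eigs (H ω) i)) - A)])
    _ ≤ ENNReal.ofReal (Real.exp A) * ENNReal.ofReal (Real.exp B) := by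
        rw [lintegral_const_mul' _ _ ENNReal.ofReal_ne_top]
        gcongr
    _ = _ := by rw [← ENNReal.ofReal_mul (Real.exp_pos _).le, ← Real.exp_add]

theorem exp_logTrunc_sub_bump_le {M x : ℝ} (hM : 0 ≤ M) (hη : 0 < η) (hη1 : η ≤ 1)
    (hx : x ∉ Set.Icc (-(Real.exp (-M))) (Real.exp (-M))) :
    Real.exp (logTrunc η x - M * bump η x) ≤ |x| := by
  have hx' : Real.exp (-M) < |x| := by
    by_contra! h
    exact hx (Set.mem_Icc.2 (abs_le.1 h))
  have hx0 : 0 < |x| := (Real.exp_pos _).trans hx'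
  rw [← Real.le_log_iff_exp_le hx0]
  rcases le_or_gt η |x| with h | h
  · have := mul_nonneg hM (bump_nonneg (η := η) x)
    rw [logTrunc, max_eq_left h]
    linarith
  · rw [logTrunc, max_eq_right h.le, bump_eq_one hη h.le]
    have h1 := Real.log_nonpos hη.le hη1
    have h2 := ((Real.lt_log_iff_exp_lt hx0).2 hx').le
    linarith

theorem le_lintegral_abs_det [IsProbabilityMeasure P]
    (hmeas : ∀ i j, Measurable fun ω => H ω i j) (hsymm : ∀ ω, (H ω).IsHermitian)
    {M : ℝ} (hM : 0 ≤ M) (hη : 0 < η) (hη1 : η ≤ 1)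
    (hB4 : Real.log 4 ≤ B)
    (hB : ∫⁻ ω, ENNReal.ofReal (Real.exp
        |(∑ i, (logTrunc η (eigs (H ω) i) - M * bump η (eigs (H ω) i))) - A|) ∂P
      ≤ ENNReal.ofReal (Real.exp B))
    (hgap : 3 / 4 ≤ (P {ω | ∀ i, eigs (H ω) i ∉
      Set.Icc (-(Real.exp (-M))) (Real.exp (-M))}).toReal) :
    ENNReal.ofReal (Real.exp (A - 2 * B) / 2) ≤ ∫⁻ ω, ENNReal.ofReal |(H ω).det| ∂P := by
  have hcont : Continuous fun x => logTrunc η x - M * bump η x :=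
    (continuous_of_abs_sub_le (abs_logTrunc_sub_le hη)).sub
      ((continuous_of_abs_sub_le (abs_bump_sub_le hη)).const_mul M)
  have hS := measurable_sum_eigs hmeas hsymm hcont
  set S : Ω → ℝ := fun ω => ∑ i, (logTrunc η (eigs (H ω) i) - M * bump η (eigs (H ω) i))
  set bad := {ω | ENNReal.ofReal (Real.exp (2 * B)) ≤ ENNReal.ofReal (Real.exp |S ω - A|)}
  set good := {ω | ENNReal.ofReal (Real.exp (A - 2 * B)) ≤ ENNReal.ofReal |(H ω).det|}
  have hbad : (P bad).toReal ≤ 1 / 4 := by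
    have h : ENNReal.ofReal (Real.exp (2 * B)) * P bad ≤ ENNReal.ofReal (Real.exp B) :=
      (mul_meas_ge_le_lintegral (μ := P) (Real.measurable_exp.comp
        (hS.sub_const A).abs).ennreal_ofReal (ENNReal.ofReal (Real.exp (2 * B)))).trans hB
    have h' := ENNReal.toReal_mono ENNReal.ofReal_ne_top h
    rw [ENNReal.toReal_mul, ENNReal.toReal_ofReal (Real.exp_pos _).le,
      ENNReal.toReal_ofReal (Real.exp_pos _).le, two_mul, Real.exp_add, mul_assoc] at h'
    have h4 : 4 ≤ Real.exp B := (Real.log_le_iff_le_exp (by norm_num)).1 hB4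
    have h'' : Real.exp B * (P bad).toReal ≤ 1 := by
      have := Real.exp_pos B
      exact le_of_mul_le_mul_left (by rwa [mul_one]) this
    have hnn : 0 ≤ (P bad).toReal := ENNReal.toReal_nonneg
    nlinarith
  have hsub : {ω | ∀ i, eigs (H ω) i ∉ Set.Icc (-(Real.exp (-M))) (Real.exp (-M))}
      ⊆ bad ∪ good := by
    intro ω hω
    by_cases hb : ω ∈ bad
    · exact Or.inl hb
    refine Or.inr (ENNReal.ofReal_le_ofReal ?_)
    have hb' : |S ω - A| < 2 * B := by
      by_contra! h
      exact hb (ENNReal.ofReal_le_ofReal (Real.exp_le_exp.2 h))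
    rw [abs_det_eq_prod_eigs (hsymm ω)]
    calc Real.exp (A - 2 * B) ≤ Real.exp (S ω) :=
          Real.exp_le_exp.2 (by linarith [(abs_lt.1 hb').1])
      _ = ∏ i, Real.exp (logTrunc η (eigs (H ω) i) - M * bump η (eigs (H ω) i)) :=
          Real.exp_sum _ _
      _ ≤ _ := Finset.prod_le_prod (fun i _ => (Real.exp_pos _).le) fun i _ =>
          exp_logTrunc_sub_bump_le hM hη hη1 (hω i)
  have hgood : 1 / 2 ≤ (P good).toReal := by
    have h := ENNReal.toReal_mono (ENNReal.add_ne_top.2 ⟨measure_ne_top P bad,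
      measure_ne_top P good⟩) ((measure_mono hsub).trans (measure_union_le bad good))
    rw [ENNReal.toReal_add (measure_ne_top _ _) (measure_ne_top _ _)] at h
    linarith
  calc ENNReal.ofReal (Real.exp (A - 2 * B) / 2)
      = ENNReal.ofReal (Real.exp (A - 2 * B)) * ENNReal.ofReal (1 / 2) := by
        rw [← ENNReal.ofReal_mul (Real.exp_pos _).le]
        ring_nf
    _ ≤ ENNReal.ofReal (Real.exp (A - 2 * B)) * P good := by
        gcongr
        exact ENNReal.ofReal_le_of_le_toReal hgood
    _ ≤ _ := mul_meas_ge_le_lintegral (measurable_det_of_apply hmeas).abs.ennreal_ofReal _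

end Determinant

theorem abs_inv_mul_log_toReal_sub_le {n I δ : ℝ} (hn : 0 < n) (hδ : Real.log 2 ≤ n * δ)
    {D : ℝ≥0∞} (hup : D ≤ ENNReal.ofReal (Real.exp (n * (I + 4 * δ))))
    (hlow : ENNReal.ofReal (Real.exp (n * (I - 3 * δ)) / 2) ≤ D) :
    |n⁻¹ * Real.log D.toReal - I| ≤ 4 * δ := by
  have hD : D ≠ ⊤ := ne_top_of_le_ne_top ENNReal.ofReal_ne_top hup
  have h1 : D.toReal ≤ Real.exp (n * (I + 4 * δ)) :=
    ENNReal.toReal_le_of_le_ofReal (Real.exp_pos _).le hup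
  have h2 : Real.exp (n * (I - 3 * δ)) / 2 ≤ D.toReal := (ENNReal.ofReal_le_iff_le_toReal hD).1 hlow
  have hpos : 0 < D.toReal := lt_of_lt_of_le (by positivity) h2
  have h3 := (Real.log_le_iff_le_exp hpos).2 h1
  have h4 := Real.log_le_log (by positivity) h2
  rw [Real.log_div (Real.exp_pos _).ne' two_ne_zero, Real.log_exp] at h4
  have : n⁻¹ * Real.log D.toReal - I = n⁻¹ * (Real.log D.toReal - n * I) := by field_simp
  rw [this, abs_mul, abs_of_pos (inv_pos.2 hn), inv_mul_le_iff₀ hn, abs_le]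
  constructor <;> nlinarith

/-- **Concentrated input.** Under (W) a Wasserstein approximation of the mean spectral
measure by compactly supported measures `μ_N` with mild density control near `0`,
(L) concentration for Lipschitz linear eigenvalue statistics, and the Wegner-type gap
condition, the exponential growth rate of `E[|det H_N|]` is `∫ log|λ| μ_N(dλ)`. -/
theorem concentrated_input
    (κ : ℝ) (hκ : 0 < κ)
    (Ω : ℕ → Type*) (mΩ : ∀ N, MeasurableSpace (Ω N))
    (P : ∀ N, Measure (Ω N)) (hP : ∀ N, IsProbabilityMeasure (P N))
    (H : ∀ N, Ω N → Matrix (Fin N) (Fin N) ℝ)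
    (hmeas : ∀ N, ∀ i j, Measurable fun ω => H N ω i j)
    (hsymm : ∀ N ω, (H N ω).IsHermitian)
    (μ : ℕ → Measure ℝ) (hμprob : ∀ N, IsProbabilityMeasure (μ N))
    -- (W) Wasserstein-1 approximation:
    (hW1 : ∀ N : ℕ, 1 ≤ N → W1 (meanSpec (P N) (H N)) (μ N) ≤ (N : ℝ) ^ (-κ))
    -- common compact support:
    (hsupp : ∃ R : ℝ, 0 < R ∧ ∀ N, (μ N) (Set.Icc (-R) R)ᶜ = 0)
    -- density `μ_N(x) < κ⁻¹ |x|^{−1+κ}` on `(−κ, κ)`: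
    (hdens : ∃ ρ : ℕ → ℝ → ℝ,
      (∀ N, ∀ s ⊆ Set.Ioo (-κ) κ, MeasurableSet s →
        μ N s = ∫⁻ x in s, ENNReal.ofReal (ρ N x) ∂MeasureTheory.volume) ∧
      (∀ N, ∀ x : ℝ, |x| < κ → ρ N x < κ⁻¹ * |x| ^ (-1 + κ)))
    -- (L) concentration for Lipschitz traces:
    (hLip : ∃ ε₀ : ℝ, 0 < ε₀ ∧ ∀ ζ : ℝ, 0 < ζ → ∃ c : ℝ, 0 < c ∧
      ∀ N : ℕ, 1 ≤ N → ∀ f : ℝ → ℝ, ∀ L : ℝ, 0 < L →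
        (∀ x y, |f x - f y| ≤ L * |x - y|) → ∀ δ : ℝ, 0 < δ →
        (P N {ω | δ < |(N : ℝ)⁻¹ * (∑ i, f (eigs (H N ω) i))
            - (N : ℝ)⁻¹ * ∫ ω', (∑ i, f (eigs (H N ω') i)) ∂(P N)|}).toReal
          ≤ Real.exp (-(c / (N : ℝ) ^ ζ) *
              min (((N : ℝ) * δ / L) ^ (2 : ℝ)) (((N : ℝ) * δ / L) ^ (1 + ε₀))))
    -- Wegner-type gap condition:
    (hgap : ∀ ε : ℝ, 0 < ε →
      Tendsto (fun N : ℕ =>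
          (P N {ω | ∀ i, eigs (H N ω) i ∉
              Set.Icc (-(Real.exp (-(N : ℝ) ^ ε))) (Real.exp (-(N : ℝ) ^ ε))}).toReal)
        atTop (nhds 1)) :
    Tendsto (fun N : ℕ =>
        (N : ℝ)⁻¹ * Real.log
            (∫⁻ ω, ENNReal.ofReal |(H N ω).det| ∂(P N)).toReal
          - ∫ lam, Real.log |lam| ∂(μ N))
      atTop (nhds 0) := by
  obtain ⟨R, -, hR⟩ := hsupp
  obtain ⟨ρ, hρint, hρ⟩ := hdens
  obtain ⟨ε₀, hε₀, hLip⟩ := hLip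
  have he : 0 < min 1 ε₀ := lt_min one_pos hε₀
  obtain ⟨c, hc, hLip⟩ := hLip (min 1 ε₀ / 4) (by positivity)
  obtain ⟨b, hb, hb8, hbκ⟩ : ∃ b : ℝ, 0 < b ∧ 8 * b ≤ min 1 ε₀ ∧ b < κ :=
    ⟨min (min 1 ε₀ / 8) (κ / 2), by positivity,
      by linarith [min_le_left (min 1 ε₀ / 8) (κ / 2)],
      by linarith [min_le_right (min 1 ε₀ / 8) (κ / 2)]⟩
  set s := κ / 2
  have hs : 0 < s := by positivity
  set a := b / 2 with ha_def
  have ha : 0 < a := by positivity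
  obtain ⟨ε, hε, hεb, hεs⟩ : ∃ ε : ℝ, 0 < ε ∧ a + ε ≤ b ∧ ε < a * s :=
    ⟨min (b / 2) (a * s / 2), by positivity,
      by linarith [min_le_left (b / 2) (a * s / 2)],
      by linarith [min_le_right (b / 2) (a * s / 2), mul_pos ha hs]⟩
  set K := ∫ x in Set.Ioo (-κ) κ, κ⁻¹ * |x| ^ (-1 + κ / 2) with hK_def
  have hK : 0 ≤ K := integral_nonneg fun x => by positivity
  have hmom : ∀ N, ∫⁻ x in Set.Ioo (-κ) κ, ENNReal.ofReal (|x| ^ (-s)) ∂(μ N)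
      ≤ ENNReal.ofReal K := by
    intro N
    refine (setLIntegral_rpow_neg_le (hρint N) (hρ N)).trans_eq ?_
    rw [hK_def, ofReal_integral_eq_lintegral_ofReal]
    · exact (integrableOn_abs_rpow (by linarith)).const_mul _
    · exact Eventually.of_forall fun x => by positivity
  have h0 : ∀ N, μ N {0} = 0 := fun N => measure_singleton_zero_of_density hκ (hρint N)
  have habs : ∀ N, Integrable (fun x : ℝ => |x|) (μ N) := fun N =>
    integrable_of_continuous_of_support (hR N) continuous_abs
  rw [Metric.tendsto_nhds]
  intro τ hτ
  set δ := τ / 8 with hδ_def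
  have hδ : 0 < δ := by positivity
  have tη : Tendsto (fun N : ℕ => (N : ℝ) ^ (-a)) atTop (nhds 0) :=
    (tendsto_rpow_neg_atTop ha).comp tendsto_natCast_atTop_atTop
  have t2η : Tendsto (fun N : ℕ => 2 * (N : ℝ) ^ (-a)) atTop (nhds 0) := by
    simpa using tη.const_mul 2
  have tlog : Tendsto (fun N : ℕ => ((N : ℝ) ^ (-a)) ^ s / s * K) atTop (nhds 0) := by
    have h := ((tη.rpow_const (p := s) (Or.inr hs.le)).div_const s).mul_const K
    simpa [Real.zero_rpow hs.ne'] using h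
  have tbump : Tendsto (fun N : ℕ => (N : ℝ) ^ ε * ((2 * (N : ℝ) ^ (-a)) ^ s * K))
      atTop (nhds 0) := by
    have h : Tendsto (fun N : ℕ => 2 ^ s * K * (N : ℝ) ^ (-(a * s - ε))) atTop (nhds 0) := by
      simpa using ((tendsto_rpow_neg_atTop (sub_pos.2 hεs)).comp
        tendsto_natCast_atTop_atTop).const_mul (2 ^ s * K)
    refine h.congr' ?_
    filter_upwards [eventually_ge_atTop 1] with N hN
    have hN0 : (0 : ℝ) < N := by exact_mod_cast hN
    rw [Real.mul_rpow two_pos.le (by positivity), ← Real.rpow_mul hN0.le,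
      show -(a * s - ε) = ε + -a * s by ring, Real.rpow_add hN0]
    ring
  have tN : Tendsto (fun N : ℕ => (N : ℝ) * δ) atTop atTop :=
    tendsto_natCast_atTop_atTop.atTop_mul_const hδ
  filter_upwards [eventually_lintegral_exp_le P hmeas hsymm μ habs hW1 hε₀ hc hδ hb hb8 hbκ hLip,
    t2η.eventually (ge_mem_nhds hκ), tlog.eventually (ge_mem_nhds hδ),
    tbump.eventually (ge_mem_nhds hδ),
    (hgap ε hε).eventually (le_mem_nhds (show (3 / 4 : ℝ) < 1 by norm_num)),
    tN.eventually_ge_atTop (Real.log 4), eventually_ge_atTop 1]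
    with N hconc hηκ hlogK hbumpK hgapN hlog4 hN
  have hN1 : (1 : ℝ) ≤ N := by exact_mod_cast hN
  have hN0 : (0 : ℝ) < N := by linarith
  set η := (N : ℝ) ^ (-a) with hη_def
  have hη : 0 < η := Real.rpow_pos_of_pos hN0 _
  have hη1 : η ≤ 1 := Real.rpow_le_one_of_one_le_of_nonpos hN1 (by linarith)
  have hηinv : η⁻¹ = (N : ℝ) ^ a := by rw [hη_def, Real.rpow_neg hN0.le, inv_inv]
  set M := (N : ℝ) ^ ε with hM_def
  have hM1 : 1 ≤ M := Real.one_le_rpow hN1 hε.le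
  have hlip : (1 + M) * η⁻¹ ≤ 2 * (N : ℝ) ^ b := by
    have h : M * η⁻¹ ≤ (N : ℝ) ^ b := by
      rw [hηinv, hM_def, ← Real.rpow_add hN0]
      exact Real.rpow_le_rpow_of_exponent_le hN1 (by linarith)
    have h' := mul_le_mul_of_nonneg_right hM1 (inv_pos.2 hη).le
    linarith
  obtain ⟨hI1, hI2, hI3⟩ :=
    integral_logTrunc_bounds hs hK (hR N) (h0 N) (hmom N) hη hηκ
  set I := ∫ x, Real.log |x| ∂(μ N)
  have hup : ∫⁻ ω, ENNReal.ofReal |(H N ω).det| ∂(P N)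
      ≤ ENNReal.ofReal (Real.exp (N * (I + 4 * δ))) := by
    refine (lintegral_abs_det_le (hsymm N) hη (hconc (logTrunc η) fun x y => ?_)).trans ?_
    · refine (abs_logTrunc_sub_le hη x y).trans
        (mul_le_mul_of_nonneg_right (le_trans ?_ hlip) (abs_nonneg _))
      exact le_mul_of_one_le_left (inv_pos.2 hη).le (by linarith)
    · refine ENNReal.ofReal_le_ofReal (Real.exp_le_exp.2 ?_)
      rw [← mul_add]
      exact mul_le_mul_of_nonneg_left (by linarith) hN0.le
  have hlow : ENNReal.ofReal (Real.exp (N * (I - 3 * δ)) / 2)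
      ≤ ∫⁻ ω, ENNReal.ofReal |(H N ω).det| ∂(P N) := by
    refine le_trans ?_ (le_lintegral_abs_det (hmeas N) (hsymm N) (by linarith) hη hη1 hlog4
      (hconc (fun x => logTrunc η x - M * bump η x) fun x y => ?_) hgapN)
    · refine ENNReal.ofReal_le_ofReal (div_le_div_of_nonneg_right (Real.exp_le_exp.2 ?_) two_pos.le)
      rw [integral_sub (integrable_of_continuous_of_support (hR N)
          (continuous_of_abs_sub_le (abs_logTrunc_sub_le hη)))
        ((integrable_of_continuous_of_support (hR N)
          (continuous_of_abs_sub_le (abs_bump_sub_le hη))).const_mul M), integral_const_mul]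
      have h := mul_le_mul_of_nonneg_left hI3 (by linarith : (0 : ℝ) ≤ M)
      rw [mul_left_comm 2, ← mul_sub]
      exact mul_le_mul_of_nonneg_left (by linarith) hN0.le
    · have h1 := abs_logTrunc_sub_le hη x y
      have h2 := mul_le_mul_of_nonneg_left (abs_bump_sub_le hη x y) (by linarith : (0 : ℝ) ≤ M)
      have h3 := mul_le_mul_of_nonneg_right hlip (abs_nonneg (x - y))
      have h4 := abs_sub (logTrunc η x - logTrunc η y) (M * (bump η x - bump η y))
      rw [abs_mul, abs_of_nonneg (by linarith : (0 : ℝ) ≤ M)] at h4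
      rw [show logTrunc η x - M * bump η x - (logTrunc η y - M * bump η y)
        = logTrunc η x - logTrunc η y - M * (bump η x - bump η y) by ring]
      linarith
  rw [Real.dist_eq, sub_zero]
  refine (abs_inv_mul_log_toReal_sub_le hN0 (le_trans ?_ hlog4) hup hlow).trans_lt (by linarith)
  exact Real.log_le_log two_pos (by norm_num)
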